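/- Let W be a finite set of Wang tiles and let L be any set of formulas with TWJ⁺ ⊆ L ⊆ Log(𝒫_fin(ℕ), ∪, ∅), where TWJ⁺ denotes the set of formulas derivable in the Hilbert system TWJ⁺. Then ψ_W ∉ L if and only if W tiles ℤ². -/

import Mathlib

/-- Formulas of the language 𝓛: propositional letters (indexed by ℕ) with ∧, ∨, →. -/
inductive Fml : Type
  | atom : ℕ → Fml
  | and : Fml → Fml → Fml
  | or : Fml → Fml → Fml
  | imp : Fml → Fml → Fml
deriving DecidableEq

/-- A Wang tile: a quadruple `(t_W, t_E, t_N, t_S)` of natural numbers. -/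
abbrev Tile : Type := ℕ × ℕ × ℕ × ℕ

/-- West colour. -/
def tW (t : Tile) : ℕ := t.1
/-- East colour. -/
def tE (t : Tile) : ℕ := t.2.1
/-- North colour. -/
def tN (t : Tile) : ℕ := t.2.2.1
/-- South colour. -/
def tS (t : Tile) : ℕ := t.2.2.2

/-- `W` tiles `D ⊆ ℤ²`: there is a map assigning to each point of `D` a tile of `W`
such that horizontally and vertically adjacent tiles within `D` match. -/
def Tiles (W : Finset Tile) (D : Set (ℤ × ℤ)) : Prop :=
  ∃ τ : ℤ × ℤ → Tile,
    (∀ p ∈ D, τ p ∈ W) ∧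
    (∀ m n : ℤ, (m, n) ∈ D → (m + 1, n) ∈ D → tE (τ (m, n)) = tW (τ (m + 1, n))) ∧
    (∀ m n : ℤ, (m, n) ∈ D → (m, n + 1) ∈ D → tN (τ (m, n)) = tS (τ (m, n + 1)))

/-- The `k`-quadrant `ℚ(k) = {(m,n) : 0 ≤ m,n ≤ k}`. -/
def Quadrant (k : ℕ) : Set (ℤ × ℤ) :=
  {p | 0 ≤ p.1 ∧ p.1 ≤ (k : ℤ) ∧ 0 ≤ p.2 ∧ p.2 ≤ (k : ℤ)}

/-- The `k`-octant `𝕆(k) = {(m,n) : 0 ≤ m ≤ n ≤ k}`. -/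
def Octant (k : ℕ) : Set (ℤ × ℤ) :=
  {p | 0 ≤ p.1 ∧ p.1 ≤ p.2 ∧ p.2 ≤ (k : ℤ)}

/-- The propositional letters used in the tiling formulas: one letter `𝚝` for each
tile `t`, letters `𝚖_{i,j}` for `i,j ∈ {0,1}` (here indexed by `Bool`, `false = 0`,
`true = 1`), and letters `𝚡`, `𝚢`, `𝚙⊤`. -/
inductive Letter : Type
  | tile : Tile → Letter
  | m : Bool → Bool → Letter
  | x : Letter
  | y : Letter
  | pTop : Letter
deriving DecidableEq

/-- Disjunction of a list of formulas (a given default for the empty list). -/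
def bigOr (dflt : Fml) : List Fml → Fml
  | [] => dflt
  | f :: fs => fs.foldl .or f

/-- Conjunction of a list of formulas (a given default for the empty list). -/
def bigAnd (dflt : Fml) : List Fml → Fml
  | [] => dflt
  | f :: fs => fs.foldl .and f

/-- Product of two lists. -/
def listProd {α β : Type*} (l₁ : List α) (l₂ : List β) : List (α × β) :=
  l₁.foldr (fun a acc => (l₂.map fun b => (a, b)) ++ acc) []

/-- The four pairs `(i,j)` with `i,j ∈ {0,1}`. -/
def boolPairs : List (Bool × Bool) :=
  [(false, false), (false, true), (true, false), (true, true)]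

variable (enc : Letter → ℕ)

/-- The atom `𝚝` for a tile `t`. -/
def tAt (t : Tile) : Fml := .atom (enc (.tile t))
/-- The atom `𝚖_{i,j}`. -/
def mAt (i j : Bool) : Fml := .atom (enc (.m i j))
/-- The atom `𝚡`. -/
def xAt : Fml := .atom (enc .x)
/-- The atom `𝚢`. -/
def yAt : Fml := .atom (enc .y)
/-- The atom `𝚙⊤`. -/
def pAt : Fml := .atom (enc .pTop)

/-- The surrogate used for an empty disjunction: `𝚖_{0,0} ∧ 𝚖_{0,1}`. -/
def emptyOr : Fml := .and (mAt enc false false) (mAt enc false true)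

/-- The surrogate used for an empty conjunction: `𝚙⊤ → 𝚙⊤`. -/
def emptyAnd : Fml := .imp (pAt enc) (pAt enc)

/-- `R(t) = ⋁{𝚝' : t' ∈ W, t_E = t'_W}`: the permissible rightwards neighbours. -/
noncomputable def Rt (W : Finset Tile) (t : Tile) : Fml :=
  bigOr (emptyOr enc) (((W.filter fun t' => tE t = tW t').toList).map (tAt enc))

/-- `U(t) = ⋁{𝚝' : t' ∈ W, t_N = t'_S}`: the permissible upwards neighbours. -/
noncomputable def Ut (W : Finset Tile) (t : Tile) : Fml :=
  bigOr (emptyOr enc) (((W.filter fun t' => tN t = tS t').toList).map (tAt enc))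

/-- The grid formula `G_{i,j}`. -/
noncomputable def Gf (W : Finset Tile) (i j : Bool) : Fml :=
  .and (mAt enc i j)
    (bigOr (emptyOr enc)
      ((W.toList).map fun t =>
        .and (tAt enc t)
          (.imp (yAt enc)
            (.or (mAt enc i j) (.and (mAt enc i (!j)) (Ut enc W t))))))

/-- The formula `x'`. -/
noncomputable def xPrime (W : Finset Tile) : Fml :=
  .and (xAt enc) <| .and (pAt enc) <| .and (.imp (pAt enc) (pAt enc)) <|
    .and (bigAnd (emptyAnd enc)
        ((listProd (W.toList) boolPairs).map fun q =>
          .imp (.and (mAt enc q.2.1 q.2.2) (tAt enc q.1))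
            (.or (mAt enc q.2.1 q.2.2) (.and (mAt enc (!q.2.1) q.2.2) (Rt enc W q.1))))) <|
      .and (bigAnd (emptyAnd enc)
          ((listProd boolPairs boolPairs).filterMap fun q =>
            if q.1 ≠ q.2 then
              some (.imp (.and (mAt enc q.1.1 q.1.2) (mAt enc q.2.1 q.2.2))
                (.and (mAt enc false false) (mAt enc false true)))
            else none))
        (bigAnd (emptyAnd enc)
          ((listProd (W.toList) (W.toList)).filterMap fun q =>
            if q.1 ≠ q.2 then
              some (.imp (.and (tAt enc q.1) (tAt enc q.2))
                (.and (mAt enc false false) (mAt enc false true)))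
            else none))

/-- The formula `y' = 𝚢 ∧ 𝚙⊤ ∧ (𝚙⊤ → 𝚙⊤)`. -/
def yPrime : Fml := .and (yAt enc) (.and (pAt enc) (.imp (pAt enc) (pAt enc)))

/-- The notational complement `m^c_{i,j} = 𝚖_{i,1−j} ∨ 𝚖_{1−i,j} ∨ 𝚖_{1−i,1−j}`. -/
def mc (i j : Bool) : Fml :=
  .or (mAt enc i (!j)) (.or (mAt enc (!i) j) (mAt enc (!i) (!j)))

/-- The formula `α = ⋀_{i,j} (m^c_{i,j} → m^c_{i,j})`. -/
def alphaF : Fml :=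
  bigAnd (emptyAnd enc) (boolPairs.map fun q => .imp (mc enc q.1 q.2) (mc enc q.1 q.2))

/-- The formula `β₁ = ⋀_{i} ((y' → m^c_{i,i}) → m^c_{i,1−i})`. -/
def beta1F : Fml :=
  .and (.imp (.imp (yPrime enc) (mc enc false false)) (mc enc false true))
    (.imp (.imp (yPrime enc) (mc enc true true)) (mc enc true false))

/-- The formula `β₂ = ⋀_{i} ((x' → m^c_{1−i,i}) → m^c_{i,i})`. -/
noncomputable def beta2F (W : Finset Tile) : Fml :=
  .and (.imp (.imp (xPrime enc W) (mc enc true false)) (mc enc false false))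
    (.imp (.imp (xPrime enc W) (mc enc false true)) (mc enc true true))

/-- The formula `γ = 𝚙⊤ → ⋁_{i,j} G_{i,j}`. -/
noncomputable def gammaF (W : Finset Tile) : Fml :=
  .imp (pAt enc) (bigOr (emptyOr enc) (boolPairs.map fun q => Gf enc W q.1 q.2))

/-- The tiling formula `ψ_W = (α ∧ β₁ ∧ β₂ ∧ γ ∧ G_{0,0}) → (x' → m^c_{1,0})`. -/
noncomputable def psiW (W : Finset Tile) : Fml :=
  .imp
    (.and (alphaF enc) (.and (beta1F enc) (.and (beta2F enc W)
      (.and (gammaF enc W) (Gf enc W false false)))))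
    (.imp (xPrime enc W) (mc enc true false))

/-- Satisfaction in a semilattice model `(S, ⊔, V)`: the implication clause is
`x ⊩ φ → ψ` iff for all `y`, `y ⊩ φ` implies `x ⊔ y ⊩ ψ`. -/
def SatS {S : Type*} (sup : S → S → S) (V : ℕ → Set S) : S → Fml → Prop
  | x, .atom p => x ∈ V p
  | x, .and φ ψ => SatS sup V x φ ∧ SatS sup V x ψ
  | x, .or φ ψ => SatS sup V x φ ∨ SatS sup V x ψ
  | x, .imp φ ψ => ∀ y, SatS sup V y φ → SatS sup V (sup x y) ψ

/-- Derivability in the Hilbert system TWJ⁺. -/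
inductive TWJ : Fml → Prop
  | id (φ : Fml) : TWJ (.imp φ φ)
  | andE1 (φ ψ : Fml) : TWJ (.imp (.and φ ψ) φ)
  | andE2 (φ ψ : Fml) : TWJ (.imp (.and φ ψ) ψ)
  | andI (φ ψ χ : Fml) :
      TWJ (.imp (.and (.imp φ ψ) (.imp φ χ)) (.imp φ (.and ψ χ)))
  | orI1 (φ ψ : Fml) : TWJ (.imp φ (.or φ ψ))
  | orI2 (φ ψ : Fml) : TWJ (.imp ψ (.or φ ψ))
  | orE (φ ψ χ : Fml) :
      TWJ (.imp (.and (.imp φ χ) (.imp ψ χ)) (.imp (.or φ ψ) χ))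
  | distrib (φ ψ χ : Fml) :
      TWJ (.imp (.and φ (.or ψ χ)) (.or (.and φ ψ) (.and φ χ)))
  | hypSyll (φ ψ χ : Fml) :
      TWJ (.imp (.and (.imp φ ψ) (.imp ψ χ)) (.imp φ χ))
  | prefixing (φ ψ χ : Fml) :
      TWJ (.imp (.imp φ ψ) (.imp (.imp χ φ) (.imp χ ψ)))
  | suffixing (φ ψ χ : Fml) :
      TWJ (.imp (.imp φ ψ) (.imp (.imp ψ χ) (.imp φ χ)))
  | mp {φ ψ : Fml} : TWJ φ → TWJ (.imp φ ψ) → TWJ ψ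
  | adj {φ ψ : Fml} : TWJ φ → TWJ ψ → TWJ (.and φ ψ)

/-- Membership in `Log(𝒫_fin(ℕ), ∪, ∅)`: validity on the semilattice frame of finite
subsets of `ℕ` under union, i.e. satisfaction at `∅` in every model over it. -/
def InLogPfin (φ : Fml) : Prop :=
  ∀ V : ℕ → Set (Finset ℕ), SatS (fun X Y : Finset ℕ => X ∪ Y) V (∅ : Finset ℕ) φ

namespace TT

/-! ### Basic derived rules of TWJ⁺ -/

theorem tr {a b c : Fml} (h1 : TWJ (.imp a b)) (h2 : TWJ (.imp b c)) : TWJ (.imp a c) :=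
  .mp h1 (.mp h2 (.prefixing b c a))

theorem pre {a b : Fml} (c : Fml) (h : TWJ (.imp a b)) :
    TWJ (.imp (.imp c a) (.imp c b)) := .mp h (.prefixing a b c)

theorem suf {a b : Fml} (c : Fml) (h : TWJ (.imp a b)) :
    TWJ (.imp (.imp b c) (.imp a c)) := .mp h (.suffixing a b c)

theorem pair {a b c : Fml} (h1 : TWJ (.imp a b)) (h2 : TWJ (.imp a c)) :
    TWJ (.imp a (.and b c)) := .mp (.adj h1 h2) (.andI a b c)

theorem copair {a b c : Fml} (h1 : TWJ (.imp a c)) (h2 : TWJ (.imp b c)) :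
    TWJ (.imp (.or a b) c) := .mp (.adj h1 h2) (.orE a b c)

/-- monotonicity of implication -/
theorem impMono {a a' b b' : Fml} (h1 : TWJ (.imp a' a)) (h2 : TWJ (.imp b b')) :
    TWJ (.imp (.imp a b) (.imp a' b')) := tr (suf b h1) (pre a' h2)

/-! ### Theories -/

/-- A theory: closed under provable implication and adjunction. -/
structure Th (T : Set Fml) : Prop where
  up : ∀ {a b}, a ∈ T → TWJ (.imp a b) → b ∈ T
  adj : ∀ {a b}, a ∈ T → b ∈ T → Fml.and a b ∈ T

/-- A prime theory. -/
structure PT (T : Set Fml) : Prop where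
  th : Th T
  prime : ∀ {a b}, Fml.or a b ∈ T → a ∈ T ∨ b ∈ T

theorem PT_univ : PT (Set.univ : Set Fml) :=
  ⟨⟨fun _ _ => trivial, fun _ _ => trivial⟩, fun _ => Or.inl trivial⟩

/-- The principal theory. -/
def pr (a : Fml) : Set Fml := {b | TWJ (.imp a b)}

theorem Th_pr (a : Fml) : Th (pr a) := ⟨fun h1 h2 => tr h1 h2, fun h1 h2 => pair h1 h2⟩

theorem self_pr (a : Fml) : a ∈ pr a := TWJ.id a

/-- The product of theories. -/
def mul (S T : Set Fml) : Set Fml := {b | ∃ a ∈ T, Fml.imp a b ∈ S}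

theorem Th_mul {S T : Set Fml} (hS : Th S) (hT : Th T) : Th (mul S T) := by
  constructor
  · rintro a b ⟨c, hc, h⟩ hab
    exact ⟨c, hc, hS.up h (pre c hab)⟩
  · rintro a b ⟨c, hc, h⟩ ⟨d, hd, h'⟩
    refine ⟨_, hT.adj hc hd, hS.up (hS.adj (hS.up h (suf a (.andE1 c d)))
      (hS.up h' (suf b (.andE2 c d)))) (.andI _ _ _)⟩

theorem mul_mono {S S' T T' : Set Fml} (h1 : S ⊆ S') (h2 : T ⊆ T') : mul S T ⊆ mul S' T' := by
  rintro b ⟨a, ha, h⟩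
  exact ⟨a, h2 ha, h1 h⟩

theorem mul_B {A B C : Set Fml} (hA : Th A) : mul A (mul B C) ⊆ mul (mul A B) C := by
  rintro p ⟨f, ⟨c, hc, hb⟩, ha⟩
  exact ⟨c, hc, _, hb, hA.up ha (.prefixing _ _ _)⟩

theorem mul_B' {A B C : Set Fml} (hA : Th A) : mul B (mul A C) ⊆ mul (mul A B) C := by
  rintro p ⟨f, ⟨c, hc, ha⟩, hb⟩
  exact ⟨c, hc, _, hb, hA.up ha (.suffixing _ _ _)⟩

theorem mul_J {A B : Set Fml} (hA : Th A) : mul A (mul A B) ⊆ mul A B := by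
  rintro p ⟨f, ⟨c, hc, ha⟩, hb⟩
  exact ⟨c, hc, hA.up (hA.adj ha hb) (.hypSyll _ _ _)⟩

/-- Prime extension. -/
theorem prime_ext {T I : Set Fml} (hT : Th T)
    (hdown : ∀ a b, TWJ (.imp a b) → b ∈ I → a ∈ I)
    (hjoin : ∀ a b, a ∈ I → b ∈ I → Fml.or a b ∈ I)
    (hdis : ∀ a ∈ T, a ∉ I) :
    ∃ P, PT P ∧ T ⊆ P ∧ ∀ a ∈ P, a ∉ I := by
  obtain ⟨P, hTP, hP⟩ := zorn_subset_nonempty {P : Set Fml | Th P ∧ ∀ a ∈ P, a ∉ I} (by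
    intro c hc hch hne
    refine ⟨⋃₀ c, ⟨⟨?_, ?_⟩, ?_⟩, fun s hs => Set.subset_sUnion_of_mem hs⟩
    · rintro a b ⟨s, hs, ha⟩ hab
      exact ⟨s, hs, (hc hs).1.up ha hab⟩
    · rintro a b ⟨s, hs, ha⟩ ⟨s', hs', hb⟩
      rcases hch.total hs hs' with h | h
      · exact ⟨s', hs', (hc hs').1.adj (h ha) hb⟩
      · exact ⟨s, hs, (hc hs).1.adj ha (h hb)⟩
    · rintro a ⟨s, hs, ha⟩
      exact (hc hs).2 a ha) T ⟨hT, hdis⟩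
  obtain ⟨⟨hPth, hPd⟩, hmax⟩ := hP
  refine ⟨P, ⟨hPth, ?_⟩, hTP, hPd⟩
  intro a b hab
  by_contra hcon
  push Not at hcon
  have key : ∀ x, x ∉ P → ∃ s ∈ P, ∃ i ∈ I, TWJ (.imp (.and s x) i) := by
    intro x hx
    by_contra hno
    push Not at hno
    have hQ : {c | ∃ s ∈ P, TWJ (.imp (.and s x) c)} ⊆ P := by
      apply hmax
      · refine ⟨⟨?_, ?_⟩, ?_⟩
        · rintro c d ⟨s, hs, h⟩ hcd
          exact ⟨s, hs, tr h hcd⟩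
        · rintro c d ⟨s, hs, h⟩ ⟨s', hs', h'⟩
          refine ⟨_, hPth.adj hs hs', pair (tr ?_ h) (tr ?_ h')⟩
          · exact pair (tr (.andE1 _ _) (.andE1 _ _)) (.andE2 _ _)
          · exact pair (tr (.andE1 _ _) (.andE2 _ _)) (.andE2 _ _)
        · rintro c ⟨s, hs, h⟩ hc
          exact hno s hs c hc h
      · intro c hc
        exact ⟨c, hc, .andE1 _ _⟩
    exact hx (hQ ⟨_, hab, .andE2 _ _⟩)
  obtain ⟨s, hs, i, hi, h⟩ := key a hcon.1
  obtain ⟨s', hs', i', hi', h'⟩ := key b hcon.2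
  refine hPd _ ?_ (hjoin _ _ hi hi')
  refine hPth.up (hPth.adj (hPth.adj hs hs') hab) (tr (.distrib _ _ _) (copair ?_ ?_))
  · exact tr (pair (tr (.andE1 _ _) (.andE1 _ _)) (.andE2 _ _)) (tr h (.orI1 _ _))
  · exact tr (pair (tr (.andE1 _ _) (.andE2 _ _)) (.andE2 _ _)) (tr h' (.orI2 _ _))

theorem ext_avoid {T : Set Fml} (hT : Th T) {q : Fml} (hq : q ∉ T) :
    ∃ P, PT P ∧ T ⊆ P ∧ q ∉ P := by
  obtain ⟨P, h1, h2, h3⟩ := prime_ext (I := {a | TWJ (.imp a q)}) hT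
    (fun a b h h' => tr h h') (fun a b h h' => copair h h') (fun a ha h => hq (hT.up ha h))
  exact ⟨P, h1, h2, fun h => h3 q h (TWJ.id q)⟩

theorem squeezeR {A B C : Set Fml} (hA : Th A) (hB : Th B) (hC : PT C) (h : mul A B ⊆ C) :
    ∃ B', PT B' ∧ B ⊆ B' ∧ mul A B' ⊆ C := by
  obtain ⟨P, h1, h2, h3⟩ := prime_ext (I := {a | ∃ b, b ∉ C ∧ Fml.imp a b ∈ A}) hB
    (by
      rintro a b hab ⟨c, hc, hbc⟩
      exact ⟨c, hc, hA.up hbc (suf c hab)⟩)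
    (by
      rintro a b ⟨c, hc, hac⟩ ⟨d, hd, hbd⟩
      refine ⟨.or c d, fun hcd => (hC.prime hcd).elim hc hd, ?_⟩
      exact hA.up (hA.adj (hA.up hac (pre a (.orI1 c d))) (hA.up hbd (pre b (.orI2 c d))))
        (.orE _ _ _))
    (by
      rintro a ha ⟨c, hc, hac⟩
      exact hc (h ⟨a, ha, hac⟩))
  refine ⟨P, h1, h2, ?_⟩
  rintro b ⟨a, ha, hab⟩
  by_contra hb
  exact h3 a ha ⟨b, hb, hab⟩

theorem squeezeL {A B C : Set Fml} (hA : Th A) (hB : Th B) (hC : PT C) (h : mul A B ⊆ C) :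
    ∃ A', PT A' ∧ A ⊆ A' ∧ mul A' B ⊆ C := by
  obtain ⟨P, h1, h2, h3⟩ := prime_ext
    (I := {a | ∃ b ∈ B, ∃ c, c ∉ C ∧ TWJ (.imp a (.imp b c))}) hA
    (by
      rintro a b hab ⟨c, hc, d, hd, hbc⟩
      exact ⟨c, hc, d, hd, tr hab hbc⟩)
    (by
      rintro a b ⟨c, hc, d, hd, h1⟩ ⟨c', hc', d', hd', h2⟩
      refine ⟨_, hB.adj hc hc', .or d d', fun hcd => (hC.prime hcd).elim hd hd', ?_⟩
      exact copair (tr h1 (impMono (.andE1 _ _) (.orI1 _ _)))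
        (tr h2 (impMono (.andE2 _ _) (.orI2 _ _))))
    (by
      rintro a ha ⟨c, hc, d, hd, h1⟩
      exact hd (h ⟨c, hc, hA.up ha h1⟩))
  refine ⟨P, h1, h2, ?_⟩
  rintro b ⟨a, ha, hab⟩
  by_contra hb
  exact h3 _ hab ⟨a, ha, b, hb, TWJ.id _⟩

/-! ### Rows and the staircase -/

theorem row_exists {A : Set Fml} (hA : Th A) {q : Fml} (hqq : Fml.imp q q ∈ A)
    (B : ℕ → Set Fml) (hB : ∀ i, Th (B i)) (hAB : ∀ i, mul A (B (i + 1)) ⊆ B i)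
    (hq : q ∉ B 0) :
    ∃ r : ℕ → Set Fml, (∀ i, PT (r i)) ∧ (∀ i, B i ⊆ r i) ∧
      (∀ i, mul A (r (i + 1)) ⊆ r i) ∧ ∀ i, q ∉ r i := by
  have step : ∀ i (P : {P : Set Fml // PT P ∧ B i ⊆ P}),
      ∃ Q : {P : Set Fml // PT P ∧ B (i + 1) ⊆ P}, mul A Q.1 ⊆ P.1 := by
    rintro i ⟨P, hP, hBP⟩
    obtain ⟨Q, h1, h2, h3⟩ := squeezeR hA (hB (i + 1)) hP ((hAB i).trans hBP)
    exact ⟨⟨Q, h1, h2⟩, h3⟩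
  choose f hf using step
  obtain ⟨P0, h1, h2, h3⟩ := ext_avoid (hB 0) hq
  let r : ∀ i, {P : Set Fml // PT P ∧ B i ⊆ P} := fun i => Nat.rec ⟨P0, h1, h2⟩ f i
  have hr : ∀ i, mul A (r (i + 1)).1 ⊆ (r i).1 := fun i => hf i (r i)
  refine ⟨fun i => (r i).1, fun i => (r i).2.1, fun i => (r i).2.2, hr, ?_⟩
  intro i
  induction i with
  | zero => exact h3
  | succ i ih => exact fun h => ih (hr i ⟨q, h, hqq⟩)

theorem stair {A : Set Fml} (hA : Th A) : ∀ (n : ℕ) (q z : ℕ → Fml),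
    (∀ j, Fml.imp (q j) (q j) ∈ A) →
    (∀ j, Fml.imp (.imp (z j) (q (j + 1))) (q j) ∈ A) →
    ∀ r : ℕ → Set Fml, (∀ i, PT (r i)) → (∀ i, mul A (r (i + 1)) ⊆ r i) → (∀ i, q 0 ∉ r i) →
    ∃ s : ℕ → Set Fml, s 0 = r n ∧ (∀ j, PT (s j)) ∧ (∀ j ≤ n, q j ∉ s j) ∧
      ∀ j, mul (s j) (pr (z j)) ⊆ s (j + 1) := by
  intro n
  induction n with
  | zero =>
    intro q z hq hz r hr1 hr2 hr3
    refine ⟨fun j => Nat.casesOn j (r 0) (fun _ => Set.univ), rfl, ?_, ?_, ?_⟩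
    · rintro (_ | j)
      · exact hr1 0
      · exact PT_univ
    · intro j hj
      obtain rfl : j = 0 := by omega
      exact hr3 0
    · intro j
      exact Set.subset_univ _
  | succ n ih =>
    intro q z hq hz r hr1 hr2 hr3
    obtain ⟨c, hc1, hc2, hc3, hc4⟩ := row_exists hA (hq 1) (fun i => mul (r (i + 1)) (pr (z 0)))
      (fun i => Th_mul (hr1 _).th (Th_pr _))
      (fun i => (mul_B hA).trans (mul_mono (hr2 _) subset_rfl))
      (by
        rintro ⟨a, ha, h⟩
        exact hr3 0 (hr2 0 ⟨_, (hr1 1).th.up h (suf _ ha), hz 0⟩))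
    obtain ⟨s, hs1, hs2, hs3, hs4⟩ := ih (fun j => q (j + 1)) (fun j => z (j + 1))
      (fun j => hq _) (fun j => hz _) c hc1 hc3 hc4
    refine ⟨fun j => Nat.casesOn j (r (n + 1)) s, rfl, ?_, ?_, ?_⟩
    · rintro (_ | j)
      · exact hr1 _
      · exact hs2 j
    · rintro (_ | j) hj
      · exact hr3 _
      · exact hs3 j (by omega)
    · rintro (_ | j)
      · exact (hc2 n).trans hs1.ge
      · exact hs4 j

/-- From a diagonal to the whole octant. -/
theorem grid_exists {X Y : Set Fml} (hX : Th X) (hY : Th Y) (d : ℕ → Set Fml)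
    (hd : ∀ m, PT (d m)) (hdd : ∀ m, mul X (mul (d m) Y) ⊆ d (m + 1)) :
    ∃ g : ℕ → ℕ → Set Fml, g 0 = d ∧ (∀ i m, PT (g i m)) ∧
      (∀ i m, mul (g i m) Y ⊆ g (i + 1) m) ∧ ∀ i m, mul X (g (i + 1) m) ⊆ g i (m + 1) := by
  let Lv := {e : ℕ → Set Fml // (∀ m, PT (e m)) ∧ ∀ m, mul X (mul (e m) Y) ⊆ e (m + 1)}
  have step : ∀ e : Lv, ∃ e' : Lv, (∀ m, mul (e.1 m) Y ⊆ e'.1 m) ∧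
      ∀ m, mul X (e'.1 m) ⊆ e.1 (m + 1) := by
    rintro ⟨e, he1, he2⟩
    have : ∀ m, ∃ P, PT P ∧ mul (e m) Y ⊆ P ∧ mul X P ⊆ e (m + 1) := fun m =>
      squeezeR hX (Th_mul (he1 m).th hY) (he1 (m + 1)) (he2 m)
    choose f h1 h2 h3 using this
    refine ⟨⟨f, h1, fun m => ?_⟩, h2, h3⟩
    exact (mul_B hX).trans ((mul_mono (h3 m) subset_rfl).trans (h2 (m + 1)))
  choose F hF1 hF2 using step
  let g : ℕ → Lv := fun i => Nat.rec ⟨d, hd, hdd⟩ (fun _ e => F e) i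
  exact ⟨fun i => (g i).1, rfl, fun i => (g i).2.1, fun i => hF1 (g i), fun i => hF2 (g i)⟩

/-! ### Big conjunctions and disjunctions -/

theorem foldl_and_mem {T : Set Fml} (hT : Th T) : ∀ (l : List Fml) (f : Fml),
    l.foldl .and f ∈ T → f ∈ T ∧ ∀ a ∈ l, a ∈ T := by
  intro l
  induction l with
  | nil => intro f h; exact ⟨h, by simp⟩
  | cons b l ih =>
    intro f h
    obtain ⟨h1, h2⟩ := ih _ h
    refine ⟨hT.up h1 (.andE1 _ _), ?_⟩
    intro a ha
    rcases List.mem_cons.1 ha with rfl | ha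
    · exact hT.up h1 (.andE2 _ _)
    · exact h2 a ha

theorem bigAnd_mem {T : Set Fml} (hT : Th T) {d : Fml} {l : List Fml} (h : bigAnd d l ∈ T)
    {a : Fml} (ha : a ∈ l) : a ∈ T := by
  cases l with
  | nil => simp at ha
  | cons f l =>
    obtain ⟨h1, h2⟩ := foldl_and_mem hT l f h
    rcases List.mem_cons.1 ha with rfl | ha
    · exact h1
    · exact h2 a ha

theorem foldl_or_mem {T : Set Fml} (hT : PT T) : ∀ (l : List Fml) (f : Fml),
    l.foldl .or f ∈ T → f ∈ T ∨ ∃ a ∈ l, a ∈ T := by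
  intro l
  induction l with
  | nil => intro f h; exact Or.inl h
  | cons b l ih =>
    intro f h
    rcases ih _ h with h1 | ⟨a, ha, h1⟩
    · rcases hT.prime h1 with h | h
      · exact Or.inl h
      · exact Or.inr ⟨b, by simp, h⟩
    · exact Or.inr ⟨a, by simp [ha], h1⟩

theorem bigOr_mem {T : Set Fml} (hT : PT T) {d : Fml} {l : List Fml} (h : bigOr d l ∈ T) :
    d ∈ T ∨ ∃ a ∈ l, a ∈ T := by
  cases l with
  | nil => exact Or.inl h
  | cons f l =>
    right
    rcases foldl_or_mem hT l f h with h | ⟨a, ha, h⟩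
    · exact ⟨f, by simp, h⟩
    · exact ⟨a, by simp [ha], h⟩

theorem mem_listProd {α β : Type*} (l₁ : List α) (l₂ : List β) (p : α × β) :
    p ∈ listProd l₁ l₂ ↔ p.1 ∈ l₁ ∧ p.2 ∈ l₂ := by
  induction l₁ with
  | nil => simp [listProd]
  | cons a l ih =>
    have : listProd (a :: l) l₂ = (l₂.map fun b => (a, b)) ++ listProd l l₂ := rfl
    rw [this, List.mem_append, ih]
    obtain ⟨x, y⟩ := p
    simp only [List.mem_map, Prod.mk.injEq, List.mem_cons]
    grind

theorem mem_boolPairs (p : Bool × Bool) : p ∈ boolPairs := by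
  obtain ⟨_ | _, _ | _⟩ := p <;> simp [boolPairs]

/-! ### Extracting tiling information from prime theories -/

theorem mc_not {enc : Letter → ℕ} {g : Set Fml} (hg : Th g) {i j a b : Bool}
    (h : mc enc i j ∉ g) (hm : mAt enc a b ∈ g) : a = i ∧ b = j := by
  have h1 : mAt enc i (!j) ∉ g := fun h' => h (hg.up h' (.orI1 _ _))
  have h2 : mAt enc (!i) j ∉ g := fun h' => h (hg.up h' (tr (.orI1 _ _) (.orI2 _ _)))
  have h3 : mAt enc (!i) (!j) ∉ g := fun h' => h (hg.up h' (tr (.orI2 _ _) (.orI2 _ _)))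
  cases a <;> cases b <;> cases i <;> cases j <;> simp_all

theorem mc_not_bot {enc : Letter → ℕ} {g : Set Fml} (hg : Th g) {i j : Bool}
    (h : mc enc i j ∉ g) : emptyOr enc ∉ g := by
  intro hb
  have h1 := mc_not hg h (hg.up hb (.andE1 _ _))
  have h2 := mc_not hg h (hg.up hb (.andE2 _ _))
  rw [← h1.2] at h2
  exact absurd h2.2 (by simp)

theorem xPrime_tiles {enc : Letter → ℕ} {W : Finset Tile} {t t' : Tile} (ht : t ∈ W)
    (ht' : t' ∈ W) (hne : t ≠ t') :
    TWJ (.imp (xPrime enc W) (.imp (.and (tAt enc t) (tAt enc t')) (emptyOr enc))) := by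
  have hX := Th_pr (xPrime enc W)
  have h := self_pr (xPrime enc W)
  have h1 := hX.up (hX.up (hX.up (hX.up (hX.up h (.andE2 _ _)) (.andE2 _ _)) (.andE2 _ _))
    (.andE2 _ _)) (.andE2 _ _)
  refine bigAnd_mem hX h1 ?_
  rw [List.mem_filterMap]
  refine ⟨(t, t'), ?_, by simp [hne, emptyOr]⟩
  rw [mem_listProd]
  simp [ht, ht']

theorem xPrime_ms {enc : Letter → ℕ} {W : Finset Tile} {p p' : Bool × Bool} (hne : p ≠ p') :
    TWJ (.imp (xPrime enc W) (.imp (.and (mAt enc p.1 p.2) (mAt enc p'.1 p'.2))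
      (emptyOr enc))) := by
  have hX := Th_pr (xPrime enc W)
  have h := self_pr (xPrime enc W)
  have h1 := hX.up (hX.up (hX.up (hX.up (hX.up h (.andE2 _ _)) (.andE2 _ _)) (.andE2 _ _))
    (.andE2 _ _)) (.andE1 _ _)
  refine bigAnd_mem hX h1 ?_
  rw [List.mem_filterMap]
  refine ⟨(p, p'), ?_, by simp [hne, emptyOr]⟩
  rw [mem_listProd]
  exact ⟨mem_boolPairs _, mem_boolPairs _⟩

theorem xPrime_right {enc : Letter → ℕ} {W : Finset Tile} {t : Tile} (ht : t ∈ W) (i j : Bool) :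
    TWJ (.imp (xPrime enc W) (.imp (.and (mAt enc i j) (tAt enc t))
      (.or (mAt enc i j) (.and (mAt enc (!i) j) (Rt enc W t))))) := by
  have hX := Th_pr (xPrime enc W)
  have h := self_pr (xPrime enc W)
  have h1 := hX.up (hX.up (hX.up (hX.up h (.andE2 _ _)) (.andE2 _ _)) (.andE2 _ _))
    (.andE1 _ _)
  refine bigAnd_mem hX h1 ?_
  rw [List.mem_map]
  refine ⟨(t, (i, j)), ?_, rfl⟩
  rw [mem_listProd]
  exact ⟨by simpa using ht, mem_boolPairs _⟩

theorem xPrime_p {enc : Letter → ℕ} {W : Finset Tile} :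
    TWJ (.imp (xPrime enc W) (pAt enc)) := tr (.andE2 _ _) (.andE1 _ _)

theorem xPrime_pp {enc : Letter → ℕ} {W : Finset Tile} :
    TWJ (.imp (xPrime enc W) (.imp (pAt enc) (pAt enc))) :=
  tr (.andE2 _ _) (tr (.andE2 _ _) (.andE1 _ _))

theorem yPrime_p {enc : Letter → ℕ} :
    TWJ (.imp (yPrime enc) (pAt enc)) := tr (.andE2 _ _) (.andE1 _ _)

theorem yPrime_pp {enc : Letter → ℕ} :
    TWJ (.imp (yPrime enc) (.imp (pAt enc) (pAt enc))) := tr (.andE2 _ _) (.andE2 _ _)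

section
variable {W : Finset Tile} {enc' : Letter → ℕ} {g g' : Set Fml}

theorem bot_step (hg : PT g) (h : mul (pr (xPrime enc' W)) g ⊆ g')
    (hb : emptyOr enc' ∉ g') : emptyOr enc' ∉ g := by
  intro hb'
  exact hb (h ⟨_, hb', xPrime_ms (p := (false, false)) (p' := (false, true)) (by simp)⟩)

theorem m_unique (hg : PT g) (h : mul (pr (xPrime enc' W)) g ⊆ g')
    (hb : emptyOr enc' ∉ g') {a b a' b' : Bool} (h1 : mAt enc' a b ∈ g)
    (h2 : mAt enc' a' b' ∈ g) : a = a' ∧ b = b' := by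
  by_contra hne
  exact hb (h ⟨_, hg.th.adj h1 h2, xPrime_ms (p := (a, b)) (p' := (a', b')) (by simpa using hne)⟩)

theorem t_unique (hg : PT g) (h : mul (pr (xPrime enc' W)) g ⊆ g')
    (hb : emptyOr enc' ∉ g') {t t' : Tile} (ht : t ∈ W) (ht' : t' ∈ W) (h1 : tAt enc' t ∈ g)
    (h2 : tAt enc' t' ∈ g) : t = t' := by
  by_contra hne
  exact hb (h ⟨_, hg.th.adj h1 h2, xPrime_tiles ht ht' hne⟩)

theorem right_step (hg : PT g) (hg' : PT g') (h : mul (pr (xPrime enc' W)) g ⊆ g')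
    (hb : emptyOr enc' ∉ g') {t : Tile} (ht : t ∈ W) (h1 : tAt enc' t ∈ g) {a b : Bool}
    (h2 : mAt enc' a b ∈ g) :
    mAt enc' a b ∈ g' ∨ (mAt enc' (!a) b ∈ g' ∧ ∃ t' ∈ W, tE t = tW t' ∧ tAt enc' t' ∈ g') := by
  have h3 := h ⟨_, hg.th.adj h2 h1, xPrime_right ht a b⟩
  rcases hg'.prime h3 with h3 | h3
  · exact Or.inl h3
  · right
    refine ⟨hg'.th.up h3 (.andE1 _ _), ?_⟩
    rcases bigOr_mem hg' (hg'.th.up h3 (.andE2 _ _)) with h4 | ⟨f, hf, h4⟩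
    · exact absurd h4 hb
    · simp only [List.mem_map, Finset.mem_toList, Finset.mem_filter] at hf
      obtain ⟨t', ⟨ht', he⟩, rfl⟩ := hf
      exact ⟨t', ht', he, h4⟩

/-- the `y`-part of the grid formula for the tile `t` -/
noncomputable def yPart (enc : Letter → ℕ) (W : Finset Tile) (i j : Bool) (t : Tile) : Fml :=
  .imp (yAt enc) (.or (mAt enc i j) (.and (mAt enc i (!j)) (Ut enc W t)))

theorem Gf_m (hg : PT g) {a b : Bool} (h : Gf enc' W a b ∈ g) : mAt enc' a b ∈ g :=
  hg.th.up h (.andE1 _ _)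

theorem Gf_tile (hg : PT g) (hW : W.Nonempty ∨ emptyOr enc' ∉ g) {a b : Bool}
    (h : Gf enc' W a b ∈ g) :
    ∃ t ∈ W, tAt enc' t ∈ g ∧ yPart enc' W a b t ∈ g := by
  have h1 := hg.th.up h (.andE2 _ _)
  have h2 : ∃ f ∈ (W.toList).map fun t => Fml.and (tAt enc' t) (yPart enc' W a b t), f ∈ g := by
    rcases hW with hW | hW
    · have hne : W.toList ≠ [] := by simpa using hW.ne_empty
      revert h1
      generalize W.toList = l at hne
      intro h1
      cases l with
      | nil => exact absurd rfl hne
      | cons x l =>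
        rcases foldl_or_mem hg _ _ h1 with h | ⟨f, hf, h⟩
        · exact ⟨_, List.mem_cons_self, h⟩
        · exact ⟨f, List.mem_cons_of_mem _ hf, h⟩
    · rcases bigOr_mem hg h1 with h2 | h2
      · exact absurd h2 hW
      · exact h2
  obtain ⟨f, hf, h3⟩ := h2
  simp only [List.mem_map, Finset.mem_toList] at hf
  obtain ⟨t, ht, rfl⟩ := hf
  exact ⟨t, ht, hg.th.up h3 (.andE1 _ _), hg.th.up h3 (.andE2 _ _)⟩

theorem up_step (hg' : PT g') (h : mul g (pr (yPrime enc')) ⊆ g')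
    (hb : emptyOr enc' ∉ g') {t : Tile} {a b : Bool} (h1 : yPart enc' W a b t ∈ g) :
    mAt enc' a b ∈ g' ∨ (mAt enc' a (!b) ∈ g' ∧ ∃ t' ∈ W, tN t = tS t' ∧ tAt enc' t' ∈ g') := by
  have h3 := h ⟨_, (TWJ.andE1 _ _ : yAt enc' ∈ pr (yPrime enc')), h1⟩
  rcases hg'.prime h3 with h3 | h3
  · exact Or.inl h3
  · right
    refine ⟨hg'.th.up h3 (.andE1 _ _), ?_⟩
    rcases bigOr_mem hg' (hg'.th.up h3 (.andE2 _ _)) with h4 | ⟨f, hf, h4⟩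
    · exact absurd h4 hb
    · simp only [List.mem_map, Finset.mem_toList, Finset.mem_filter] at hf
      obtain ⟨t', ⟨ht', he⟩, rfl⟩ := hf
      exact ⟨t', ht', he, h4⟩

end

theorem grid_tiling (W : Finset Tile) (enc : Letter → ℕ) (N : ℕ) (g : ℕ → ℕ → Set Fml)
    (hg : ∀ i m, PT (g i m))
    (hY : ∀ i m, mul (g i m) (pr (yPrime enc)) ⊆ g (i + 1) m)
    (hX : ∀ i m, mul (pr (xPrime enc W)) (g (i + 1) m) ⊆ g i (m + 1))
    (hG : ∀ i m, ∃ a b, Gf enc W a b ∈ g i m)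
    (hd : ∀ m, m + 1 ≤ N → mc enc (m + 1).bodd (m + 1).bodd ∉ g 0 (m + 1))
    (h0 : Gf enc W false false ∈ g 0 0) :
    ∃ τ : ℕ → ℕ → Tile, ∀ m n, m < n → n ≤ N → τ m n ∈ W ∧
      (m + 1 < n → tE (τ m n) = tW (τ (m + 1) n)) ∧
      (n + 1 ≤ N → tN (τ m n) = tS (τ m (n + 1))) := by
  have cls : ∀ i, (∀ m, m + i ≤ N → Gf enc W m.bodd (m + i).bodd ∈ g i m) ∧
      (∀ m, m + i ≤ N → 1 ≤ m + i → mc enc m.bodd (m + i).bodd ∉ g i m) := by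
    intro i
    induction i with
    | zero =>
      have h2 : (∀ m, m + 0 ≤ N → 1 ≤ m + 0 → mc enc m.bodd (m + 0).bodd ∉ g 0 m) := by
        rintro (_ | m) h1 h2
        · omega
        · exact hd m h1
      refine ⟨?_, h2⟩
      rintro (_ | m) h1
      · exact h0
      · obtain ⟨a, b, hab⟩ := hG 0 (m + 1)
        obtain ⟨rfl, rfl⟩ := mc_not (hg _ _).th (h2 _ h1 (by omega)) (Gf_m (hg _ _) hab)
        exact hab
    | succ i ih =>
      have key : ∀ m, m + (i + 1) ≤ N → Gf enc W m.bodd (m + (i + 1)).bodd ∈ g (i + 1) m ∧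
          mc enc m.bodd (m + (i + 1)).bodd ∉ g (i + 1) m := by
        intro m hm
        have hex := ih.2 (m + 1) (by omega) (by omega)
        have hb' := mc_not_bot (hg _ _).th hex
        have hb := bot_step (hg _ _) (hX i m) hb'
        obtain ⟨a, b, hab⟩ := hG (i + 1) m
        obtain ⟨t, ht, h1, h2⟩ := Gf_tile (hg _ _) (Or.inr hb) hab
        have hm1 := Gf_m (hg _ _) hab
        have hG0 := ih.1 m (by omega)
        obtain ⟨t0, ht0, h10, h20⟩ := Gf_tile (hg _ _) (Or.inl ⟨t, ht⟩) hG0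
        have e1 : a = m.bodd ∧ (b = (m + i).bodd ∨ b = !(m + i).bodd) := by
          rcases up_step (hg _ _) (hY i m) hb h20 with h | ⟨h, -⟩
          · have := m_unique (hg _ _) (hX i m) hb' hm1 h
            exact ⟨this.1, Or.inl this.2⟩
          · have := m_unique (hg _ _) (hX i m) hb' hm1 h
            exact ⟨this.1, Or.inr this.2⟩
        have e2 : b = (m + 1 + i).bodd := by
          rcases right_step (hg _ _) (hg _ _) (hX i m) hb' ht h1 hm1 with h | ⟨h, -⟩
          · exact (mc_not (hg _ _).th hex h).2
          · exact (mc_not (hg _ _).th hex h).2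
        have e3 : m + 1 + i = m + (i + 1) := by ring
        rw [e3] at e2
        obtain ⟨rfl, -⟩ := e1
        subst e2
        refine ⟨hab, fun hc => ?_⟩
        rcases (hg _ _).prime hc with h | h
        · have := m_unique (hg _ _) (hX i m) hb' hm1 h
          simp at this
        · rcases (hg _ _).prime h with h | h
          · have := m_unique (hg _ _) (hX i m) hb' hm1 h
            simp at this
          · have := m_unique (hg _ _) (hX i m) hb' hm1 h
            simp at this
      exact ⟨fun m hm => (key m hm).1, fun m hm _ => (key m hm).2⟩
  have bot : ∀ i m, m + i ≤ N → 1 ≤ m + i → emptyOr enc ∉ g i m := fun i m h1 h2 =>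
    mc_not_bot (hg _ _).th ((cls i).2 m h1 h2)
  have ex : ∀ m n, ∃ t, m < n → n ≤ N → t ∈ W ∧ tAt enc t ∈ g (n - m) m ∧
      yPart enc W m.bodd n.bodd t ∈ g (n - m) m := by
    intro m n
    by_cases h : m < n ∧ n ≤ N
    · have h1 := (cls (n - m)).1 m (by omega)
      rw [show m + (n - m) = n by omega] at h1
      obtain ⟨t, ht⟩ := Gf_tile (hg _ _) (Or.inr (bot _ _ (by omega) (by omega))) h1
      exact ⟨t, fun _ _ => ht⟩
    · exact ⟨(0, 0, 0, 0), fun h1 h2 => absurd ⟨h1, h2⟩ h⟩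
  choose τ hτ using ex
  refine ⟨τ, fun m n hmn hn => ?_⟩
  obtain ⟨h1, h2, h3⟩ := hτ m n hmn hn
  refine ⟨h1, fun hlt => ?_, fun hle => ?_⟩
  · obtain ⟨k1, k2, -⟩ := hτ (m + 1) n hlt hn
    obtain ⟨i, rfl⟩ : ∃ i, n = m + 1 + (i + 1) := ⟨n - (m + 2), by omega⟩
    rw [show m + 1 + (i + 1) - m = i + 1 + 1 by omega] at h2
    rw [show m + 1 + (i + 1) - (m + 1) = i + 1 by omega] at k2
    have hm : mAt enc m.bodd (m + (i + 1 + 1)).bodd ∈ g (i + 1 + 1) m :=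
      Gf_m (hg _ _) ((cls _).1 m (by omega))
    rcases right_step (hg _ _) (hg _ _) (hX (i + 1) m) (bot _ _ (by omega) (by omega)) h1 h2 hm
      with h | ⟨-, t', ht', he, h⟩
    · have := mc_not (hg _ _).th ((cls (i + 1)).2 (m + 1) (by omega) (by omega)) h
      simp at this
    · rw [he, t_unique (hg _ _) (hX i (m + 1)) (bot _ _ (by omega) (by omega)) ht' k1 h k2]
  · obtain ⟨k1, k2, -⟩ := hτ m (n + 1) (by omega) hle
    obtain ⟨i, rfl⟩ : ∃ i, n = m + (i + 1) := ⟨n - (m + 1), by omega⟩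
    rw [show m + (i + 1) - m = i + 1 by omega] at h3
    rw [show m + (i + 1) + 1 - m = i + 1 + 1 by omega] at k2
    rcases up_step (hg _ _) (hY (i + 1) m) (bot _ _ (by omega) (by omega)) h3
      with h | ⟨-, t', ht', he, h⟩
    · have := mc_not (hg _ _).th ((cls (i + 1 + 1)).2 m (by omega) (by omega)) h
      rw [← add_assoc m (i + 1) 1, Nat.bodd_succ] at this
      simp at this
    · rw [he, t_unique (hg _ _) (hX (i + 1) m) (bot _ _ (by omega) (by omega)) ht' k1 h k2]

/-! ### From non-derivability to octant tilings -/

theorem octant_tiling (W : Finset Tile) (enc : Letter → ℕ) (hno : ¬ TWJ (psiW enc W)) (N : ℕ) :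
    ∃ τ : ℕ → ℕ → Tile, ∀ m n, m < n → n ≤ N → τ m n ∈ W ∧
      (m + 1 < n → tE (τ m n) = tW (τ (m + 1) n)) ∧
      (n + 1 ≤ N → tN (τ m n) = tS (τ m (n + 1))) := by
  obtain ⟨ant, hant⟩ : ∃ ant, ant = Fml.and (alphaF enc) (.and (beta1F enc) (.and (beta2F enc W)
      (.and (gammaF enc W) (Gf enc W false false)))) := ⟨_, rfl⟩
  have hself : ant ∈ pr ant := self_pr ant
  have hA : Th (pr ant) := Th_pr ant
  have ha : alphaF enc ∈ pr ant := by rw [hant]; exact TWJ.andE1 _ _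
  have hb1 : beta1F enc ∈ pr ant := by rw [hant]; exact tr (.andE2 _ _) (.andE1 _ _)
  have hb2 : beta2F enc W ∈ pr ant := by
    rw [hant]; exact tr (.andE2 _ _) (tr (.andE2 _ _) (.andE1 _ _))
  have hgam : gammaF enc W ∈ pr ant := by
    rw [hant]; exact tr (.andE2 _ _) (tr (.andE2 _ _) (tr (.andE2 _ _) (.andE1 _ _)))
  have hG0 : Gf enc W false false ∈ pr ant := by
    rw [hant]; exact tr (.andE2 _ _) (tr (.andE2 _ _) (tr (.andE2 _ _) (.andE2 _ _)))
  have halpha : ∀ i j, Fml.imp (mc enc i j) (mc enc i j) ∈ pr ant := fun i j =>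
    bigAnd_mem hA ha (List.mem_map.2 ⟨(i, j), mem_boolPairs _, rfl⟩)
  have hbeta1 : ∀ i, Fml.imp (.imp (yPrime enc) (mc enc i i)) (mc enc i (!i)) ∈ pr ant := by
    rintro (_ | _)
    · exact hA.up hb1 (.andE1 _ _)
    · exact hA.up hb1 (.andE2 _ _)
  have hbeta2 : ∀ i, Fml.imp (.imp (xPrime enc W) (mc enc (!i) i)) (mc enc i i) ∈ pr ant := by
    rintro (_ | _)
    · exact hA.up hb2 (.andE1 _ _)
    · exact hA.up hb2 (.andE2 _ _)
  set A := pr ant with hAdef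
  set X := pr (xPrime enc W) with hXdef
  set Y := pr (yPrime enc) with hYdef
  have hX : Th X := Th_pr _
  have hY : Th Y := Th_pr _
  have hAX : mc enc true false ∉ mul A X := by
    rintro ⟨f, hf, h⟩
    apply hno
    have h' : TWJ (.imp ant (.imp f (mc enc true false))) := h
    have h2 := tr h' (suf _ hf)
    rw [hant] at h2
    exact h2
  obtain ⟨r, hr1, hr2, hr3, hr4⟩ := row_exists hA (halpha true false) (fun _ => mul A X)
    (fun _ => Th_mul hA hX) (fun _ => mul_J hA) hAX
  let q : ℕ → Fml := fun j => mc enc ((j + 2) / 2).bodd ((j + 1) / 2).bodd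
  let z : ℕ → Fml := fun j => if j % 2 = 0 then yPrime enc else xPrime enc W
  have hz : ∀ j, Fml.imp (.imp (z j) (q (j + 1))) (q j) ∈ A := by
    intro j
    rcases Nat.even_or_odd' j with ⟨k, rfl | rfl⟩
    · have e1 : z (2 * k) = yPrime enc := by simp [z]
      have e2 : q (2 * k + 1) = mc enc (k + 1).bodd (k + 1).bodd := by
        simp only [q]
        rw [show (2 * k + 1 + 2) / 2 = k + 1 by omega, show (2 * k + 1 + 1) / 2 = k + 1 by omega]
      have e3 : q (2 * k) = mc enc (k + 1).bodd (!(k + 1).bodd) := by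
        simp only [q]
        rw [show (2 * k + 2) / 2 = k + 1 by omega, show (2 * k + 1) / 2 = k by omega,
          Nat.bodd_succ, Bool.not_not]
      rw [e1, e2, e3]
      exact hbeta1 _
    · have e1 : z (2 * k + 1) = xPrime enc W := by simp [z, Nat.add_mod]
      have e2 : q (2 * k + 1) = mc enc (k + 1).bodd (k + 1).bodd := by
        simp only [q]
        rw [show (2 * k + 1 + 2) / 2 = k + 1 by omega, show (2 * k + 1 + 1) / 2 = k + 1 by omega]
      have e3 : q (2 * k + 1 + 1) = mc enc (!(k + 1).bodd) (k + 1).bodd := by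
        simp only [q]
        rw [show (2 * k + 1 + 1 + 2) / 2 = (k + 1) + 1 by omega,
          show (2 * k + 1 + 1 + 1) / 2 = k + 1 by omega, Nat.bodd_succ (k + 1)]
      rw [e1, e2, e3]
      exact hbeta2 _
  obtain ⟨s, hs0, hs1, hs2, hs3⟩ := stair hA (2 * N) q z (fun j => halpha _ _) hz r hr1 hr3 hr4
  have hsY : ∀ k, mul (s (2 * k)) Y ⊆ s (2 * k + 1) := by
    intro k
    have := hs3 (2 * k)
    rwa [show z (2 * k) = yPrime enc by simp [z]] at this
  have hsX : ∀ k, mul (s (2 * k + 1)) X ⊆ s (2 * (k + 1)) := by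
    intro k
    have := hs3 (2 * k + 1)
    rwa [show z (2 * k + 1) = xPrime enc W by simp [z, Nat.add_mod]] at this
  obtain ⟨d0, hd1, hd2, hd3⟩ := squeezeL hA hX (hs1 0) ((hr2 (2 * N)).trans hs0.ge)
  let d : ℕ → Set Fml := fun k => Nat.casesOn k d0 (fun k => s (2 * k + 1))
  have hdP : ∀ k, PT (d k) := by
    rintro (_ | k)
    · exact hd1
    · exact hs1 _
  have hdX : ∀ k, mul (d k) X ⊆ s (2 * k) := by
    rintro (_ | k)
    · exact hd3
    · exact hsX k
  have hdXY : ∀ k, mul (mul (d k) X) Y ⊆ d (k + 1) := fun k =>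
    (mul_mono (hdX k) subset_rfl).trans (hsY k)
  obtain ⟨g, hg0, hgP, hgY, hgX⟩ := grid_exists hX hY d hdP
    (fun k => (mul_B' (hdP k).th).trans (hdXY k))
  -- the invariant guaranteeing the grid formulas
  let Inv : Set Fml → Prop := fun S => ∃ h, Th h ∧ pAt enc ∈ h ∧ Fml.imp (pAt enc) (pAt enc) ∈ h ∧
    mul A h ⊆ S
  have inv_mul : ∀ S Z : Set Fml, Th Z → pAt enc ∈ Z → Fml.imp (pAt enc) (pAt enc) ∈ Z →
      (A ⊆ S ∨ Inv S) → Inv (mul S Z) := by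
    rintro S Z hZ hp hpp (hS | ⟨h, h1, h2, h3, h4⟩)
    · exact ⟨Z, hZ, hp, hpp, mul_mono hS subset_rfl⟩
    · refine ⟨mul h Z, Th_mul h1 hZ, ⟨_, hp, h3⟩, ⟨_, hpp, h1.up h3 (.prefixing _ _ _)⟩, ?_⟩
      exact (mul_B hA).trans (mul_mono h4 subset_rfl)
  have inv_mono : ∀ S S' : Set Fml, S ⊆ S' → Inv S → Inv S' := by
    rintro S S' hS ⟨h, h1, h2, h3, h4⟩
    exact ⟨h, h1, h2, h3, h4.trans hS⟩
  have inv_d : ∀ k, A ⊆ d k ∨ Inv (d k) := by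
    intro k
    induction k with
    | zero => exact Or.inl hd2
    | succ k ih =>
      right
      exact inv_mono _ _ (hdXY k) (inv_mul _ _ hY yPrime_p yPrime_pp
        (Or.inr (inv_mul _ _ hX xPrime_p xPrime_pp ih)))
  have inv_g : ∀ i m, A ⊆ g i m ∨ Inv (g i m) := by
    intro i
    induction i with
    | zero => intro m; rw [hg0]; exact inv_d m
    | succ i ih =>
      intro m
      right
      exact inv_mono _ _ (hgY i m) (inv_mul _ _ hY yPrime_p yPrime_pp (ih m))
  refine grid_tiling W enc N g hgP hgY hgX ?_ ?_ ?_
  · intro i m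
    rcases inv_g i m with h | ⟨h, h1, h2, h3, h4⟩
    · exact ⟨false, false, h hG0⟩
    · have h5 := h4 ⟨_, h2, hgam⟩
      rcases foldl_or_mem (hgP i m) _ _ h5 with h6 | ⟨f, hf, h6⟩
      · exact ⟨_, _, h6⟩
      · obtain ⟨p, -, rfl⟩ := List.mem_map.1 hf
        exact ⟨_, _, h6⟩
  · intro m hm
    rw [hg0]
    have := hs2 (2 * m + 1) (by omega)
    have e2 : q (2 * m + 1) = mc enc (m + 1).bodd (m + 1).bodd := by
      simp only [q]
      rw [show (2 * m + 1 + 2) / 2 = m + 1 by omega, show (2 * m + 1 + 1) / 2 = m + 1 by omega]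
    rw [e2] at this
    exact this
  · rw [hg0]
    exact hd2 hG0

/-! ### Compactness -/

theorem tiles_of_octants (W : Finset Tile)
    (h : ∀ N : ℕ, ∃ τ : ℕ → ℕ → Tile, ∀ m n, m < n → n ≤ N → τ m n ∈ W ∧
      (m + 1 < n → tE (τ m n) = tW (τ (m + 1) n)) ∧
      (n + 1 ≤ N → tN (τ m n) = tS (τ m (n + 1)))) : Tiles W Set.univ := by
  choose τ hτ using fun k : ℕ => h (4 * k + 1)
  let σ : ℕ → ℤ → ℤ → Tile := fun k a b => τ k (a + k).toNat (b + 3 * k + 1).toNat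
  have hσ : ∀ (k : ℕ) (a b : ℤ), |a| < k → |b| < k → σ k a b ∈ W ∧
      tE (σ k a b) = tW (σ k (a + 1) b) ∧ tN (σ k a b) = tS (σ k a (b + 1)) := by
    intro k a b ha hb
    rw [abs_lt] at ha hb
    obtain ⟨h1, h2, h3⟩ := hτ k (a + k).toNat (b + 3 * k + 1).toNat (by omega) (by omega)
    refine ⟨h1, ?_, ?_⟩
    · have := h2 (by omega)
      simp only [σ]
      rw [this]
      congr 2
      omega
    · have := h3 (by omega)
      simp only [σ]
      rw [this]
      congr 2
      omega
  let U : Ultrafilter ℕ := Filter.hyperfilter ℕ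
  have hlarge : ∀ a : ℤ, ∀ᶠ k : ℕ in (U : Filter ℕ), |a| < (k : ℤ) := by
    intro a
    have : ∀ᶠ k : ℕ in Filter.atTop, |a| < (k : ℤ) := by
      filter_upwards [Filter.eventually_gt_atTop a.natAbs] with k hk
      rw [abs_lt]
      omega
    exact (Nat.hyperfilter_le_atTop) this
  have hex : ∀ a b : ℤ, ∃ t ∈ W, ∀ᶠ k in (U : Filter ℕ), σ k a b = t := by
    intro a b
    have h1 : ∀ᶠ k in (U : Filter ℕ), ∃ t ∈ (W : Set Tile), σ k a b = t := by
      filter_upwards [hlarge a, hlarge b] with k h1 h2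
      exact ⟨_, (hσ k a b h1 h2).1, rfl⟩
    exact (Ultrafilter.eventually_exists_mem_iff W.finite_toSet).1 h1
  choose T hT1 hT2 using hex
  refine ⟨fun p => T p.1 p.2, fun p _ => hT1 _ _, fun m n _ _ => ?_, fun m n _ _ => ?_⟩
  · obtain ⟨k, h1, h2, h3, h4⟩ := ((hT2 m n).and ((hT2 (m + 1) n).and
      ((hlarge m).and (hlarge n)))).exists
    simp only
    rw [← h1, ← h2]
    exact (hσ k m n h3 h4).2.1
  · obtain ⟨k, h1, h2, h3, h4⟩ := ((hT2 m n).and ((hT2 m (n + 1)).and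
      ((hlarge m).and (hlarge n)))).exists
    simp only
    rw [← h1, ← h2]
    exact (hσ k m n h3 h4).2.2

/-! ### The countermodel -/

section model
variable {S : Type*} {sup : S → S → S} {V : ℕ → Set S}

theorem sat_foldl_or (x : S) : ∀ (l : List Fml) (f : Fml),
    (SatS sup V x f ∨ ∃ a ∈ l, SatS sup V x a) → SatS sup V x (l.foldl .or f) := by
  intro l
  induction l with
  | nil => intro f h; simpa using h
  | cons b l ih =>
    intro f h
    apply ih
    simp only [SatS]
    rcases h with h | ⟨a, ha, h⟩
    · exact Or.inl (Or.inl h)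
    · rcases List.mem_cons.1 ha with rfl | ha
      · exact Or.inl (Or.inr h)
      · exact Or.inr ⟨a, ha, h⟩

theorem sat_bigOr {x : S} {d : Fml} {l : List Fml} {a : Fml} (ha : a ∈ l) (h : SatS sup V x a) :
    SatS sup V x (bigOr d l) := by
  cases l with
  | nil => simp at ha
  | cons f l =>
    apply sat_foldl_or
    rcases List.mem_cons.1 ha with rfl | ha
    · exact Or.inl h
    · exact Or.inr ⟨a, ha, h⟩

theorem sat_foldl_and (x : S) : ∀ (l : List Fml) (f : Fml),
    SatS sup V x f → (∀ a ∈ l, SatS sup V x a) → SatS sup V x (l.foldl .and f) := by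
  intro l
  induction l with
  | nil => intro f h _; simpa using h
  | cons b l ih =>
    intro f h h'
    exact ih _ ⟨h, h' b (by simp)⟩ (fun a ha => h' a (by simp [ha]))

theorem sat_bigAnd {x : S} {d : Fml} {l : List Fml} (hd : SatS sup V x d)
    (h : ∀ a ∈ l, SatS sup V x a) : SatS sup V x (bigAnd d l) := by
  cases l with
  | nil => exact hd
  | cons f l => exact sat_foldl_and x l f (h f (by simp)) (fun a ha => h a (by simp [ha]))

end model

/-- number of even elements -/
def ev (s : Finset ℕ) : ℕ := (s.filter fun k => k % 2 = 0).card
/-- number of odd elements -/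
def od (s : Finset ℕ) : ℕ := (s.filter fun k => k % 2 = 1).card

theorem ev_insert_even (s : Finset ℕ) (k : ℕ) (hk : k % 2 = 0) :
    (s ∪ {k} = s) ∨ (ev (s ∪ {k}) = ev s + 1 ∧ od (s ∪ {k}) = od s) := by
  by_cases h : k ∈ s
  · left
    simpa using h
  · right
    constructor
    · simp [ev, Finset.filter_insert, hk, h]
    · simp [od, Finset.filter_insert, hk]

theorem od_insert_odd (s : Finset ℕ) (k : ℕ) (hk : k % 2 = 1) :
    (s ∪ {k} = s) ∨ (ev (s ∪ {k}) = ev s ∧ od (s ∪ {k}) = od s + 1) := by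
  by_cases h : k ∈ s
  · left
    simpa using h
  · right
    constructor
    · simp [ev, Finset.filter_insert, hk]
    · simp [od, Finset.filter_insert, hk, h]

theorem fresh (s : Finset ℕ) (r : ℕ) (hr : r < 2) : ∃ k, k % 2 = r ∧ k ∉ s := by
  refine ⟨2 * (s.sup id + 1) + r, by omega, fun h => ?_⟩
  have := Finset.le_sup (f := id) h
  simp only [id] at this
  omega

theorem fresh_even (s : Finset ℕ) :
    ∃ k, k % 2 = 0 ∧ ev (s ∪ {k}) = ev s + 1 ∧ od (s ∪ {k}) = od s := by
  obtain ⟨k, hk, hs⟩ := fresh s 0 (by omega)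
  refine ⟨k, hk, (ev_insert_even s k hk).resolve_left ?_⟩
  intro h
  exact hs (by rw [← h]; simp)

theorem fresh_odd (s : Finset ℕ) :
    ∃ k, k % 2 = 1 ∧ ev (s ∪ {k}) = ev s ∧ od (s ∪ {k}) = od s + 1 := by
  obtain ⟨k, hk, hs⟩ := fresh s 1 (by omega)
  refine ⟨k, hk, (od_insert_odd s k hk).resolve_left ?_⟩
  intro h
  exact hs (by rw [← h]; simp)

/-- Interpretation of the letters. -/
def LV (τ : ℤ × ℤ → Tile) : Letter → Set (Finset ℕ)
  | .tile t => {s | τ (ev s, od s) = t}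
  | .m i j => {s | (ev s).bodd = i ∧ (od s).bodd = j}
  | .x => {s | ∃ k, k % 2 = 0 ∧ s = {k}}
  | .y => {s | ∃ k, k % 2 = 1 ∧ s = {k}}
  | .pTop => Set.univ

theorem not_valid (W : Finset Tile) (enc : Letter → ℕ) (henc : Function.Injective enc)
    (hW : Tiles W Set.univ) : ¬ InLogPfin (psiW enc W) := by
  obtain ⟨τ, h1, h2, h3⟩ := hW
  replace h1 : ∀ p, τ p ∈ W := fun p => h1 p trivial
  replace h2 : ∀ m n : ℤ, tE (τ (m, n)) = tW (τ (m + 1, n)) := fun m n => h2 m n trivial trivial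
  replace h3 : ∀ m n : ℤ, tN (τ (m, n)) = tS (τ (m, n + 1)) := fun m n => h3 m n trivial trivial
  intro hval
  let V : ℕ → Set (Finset ℕ) := fun p => {s | ∃ l, enc l = p ∧ s ∈ LV τ l}
  have hV : ∀ l s, s ∈ V (enc l) ↔ s ∈ LV τ l := by
    intro l s
    constructor
    · rintro ⟨l', he, h⟩
      rwa [henc he] at h
    · exact fun h => ⟨l, rfl, h⟩
  let sat : Finset ℕ → Fml → Prop := SatS (fun X Y : Finset ℕ => X ∪ Y) V
  have sm : ∀ s i j, sat s (mAt enc i j) ↔ (ev s).bodd = i ∧ (od s).bodd = j :=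
    fun s i j => hV (.m i j) s
  have st : ∀ s t, sat s (tAt enc t) ↔ τ (ev s, od s) = t := fun s t => hV (.tile t) s
  have sx : ∀ s, sat s (xAt enc) ↔ ∃ k, k % 2 = 0 ∧ s = {k} := fun s => hV .x s
  have sy : ∀ s, sat s (yAt enc) ↔ ∃ k, k % 2 = 1 ∧ s = {k} := fun s => hV .y s
  have sp : ∀ s, sat s (pAt enc) := fun s => (hV .pTop s).2 trivial
  have spp : ∀ s, sat s (.imp (pAt enc) (pAt enc)) := fun s u _ => sp _
  have smc : ∀ s i j, sat s (mc enc i j) ↔ ¬ ((ev s).bodd = i ∧ (od s).bodd = j) := by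
    intro s i j
    have : sat s (mc enc i j) ↔ (sat s (mAt enc i (!j)) ∨ sat s (mAt enc (!i) j) ∨
      sat s (mAt enc (!i) (!j))) := Iff.rfl
    rw [this, sm, sm, sm]
    cases (ev s).bodd <;> cases (od s).bodd <;> cases i <;> cases j <;> simp
  have sR : ∀ s t, tE t = tW (τ (ev s, od s)) → sat s (Rt enc W t) := by
    intro s t ht
    refine sat_bigOr (a := tAt enc (τ (ev s, od s))) ?_ ((st _ _).2 rfl)
    refine List.mem_map.2 ⟨_, ?_, rfl⟩
    simp [h1, ht]
  have sU : ∀ s t, tN t = tS (τ (ev s, od s)) → sat s (Ut enc W t) := by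
    intro s t ht
    refine sat_bigOr (a := tAt enc (τ (ev s, od s))) ?_ ((st _ _).2 rfl)
    refine List.mem_map.2 ⟨_, ?_, rfl⟩
    simp [h1, ht]
  have sxp : ∀ k, k % 2 = 0 → sat {k} (xPrime enc W) := by
    intro k hk
    refine ⟨(sx _).2 ⟨k, hk, rfl⟩, sp _, spp _, sat_bigAnd (spp _) ?_, sat_bigAnd (spp _) ?_,
      sat_bigAnd (spp _) ?_⟩
    · intro f hf
      obtain ⟨⟨t, i, j⟩, -, rfl⟩ := List.mem_map.1 hf
      rintro s ⟨hs1, hs2⟩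
      have hs1' := (sm _ _ _).1 hs1
      have hs2' := (st _ _).1 hs2
      change sat ({k} ∪ s) _
      rw [Finset.union_comm]
      rcases ev_insert_even s k hk with h | ⟨e1, e2⟩
      · rw [h]
        exact Or.inl hs1
      · right
        refine ⟨(sm _ _ _).2 ?_, sR _ _ ?_⟩
        · rw [e1, e2, Nat.bodd_succ, hs1'.1, hs1'.2]
          simp
        · rw [e1, e2, ← hs2', h2]
          push_cast
          rfl
    · intro f hf
      obtain ⟨⟨p, p'⟩, -, hpf⟩ := List.mem_filterMap.1 hf
      by_cases hpp : p = p'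
      · simp [hpp] at hpf
      · simp only [ne_eq, hpp, not_false_eq_true, if_true, Option.some.injEq] at hpf
        subst hpf
        rintro s ⟨hs1, hs2⟩
        have hs1' := (sm _ _ _).1 hs1
        have hs2' := (sm _ _ _).1 hs2
        exact absurd (Prod.ext (hs1'.1.symm.trans hs2'.1) (hs1'.2.symm.trans hs2'.2)) hpp
    · intro f hf
      obtain ⟨⟨p, p'⟩, -, hpf⟩ := List.mem_filterMap.1 hf
      by_cases hpp : p = p'
      · simp [hpp] at hpf
      · simp only [ne_eq, hpp, not_false_eq_true, if_true, Option.some.injEq] at hpf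
        subst hpf
        rintro s ⟨hs1, hs2⟩
        exact absurd (((st _ _).1 hs1).symm.trans ((st _ _).1 hs2)) hpp
  have syp : ∀ k, k % 2 = 1 → sat {k} (yPrime enc) := fun k hk =>
    ⟨(sy _).2 ⟨k, hk, rfl⟩, sp _, spp _⟩
  have sG : ∀ s, sat s (Gf enc W (ev s).bodd (od s).bodd) := by
    intro s
    refine ⟨(sm _ _ _).2 ⟨rfl, rfl⟩, ?_⟩
    refine sat_bigOr (List.mem_map.2 ⟨τ (ev s, od s), by simp [h1], rfl⟩) ?_
    refine ⟨(st _ _).2 rfl, ?_⟩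
    intro u hu
    obtain ⟨k, hk, rfl⟩ := (sy _).1 hu
    change sat (s ∪ {k}) _
    rcases od_insert_odd s k hk with h | ⟨e1, e2⟩
    · rw [h]
      exact Or.inl ((sm _ _ _).2 ⟨rfl, rfl⟩)
    · right
      refine ⟨(sm _ _ _).2 ?_, sU _ _ ?_⟩
      · rw [e1, e2, Nat.bodd_succ]
        simp
      · rw [e1, e2, h3]
        push_cast
        rfl
  have sb1 : ∀ i, sat ∅ (.imp (.imp (yPrime enc) (mc enc i i)) (mc enc i (!i))) := by
    intro i s hs
    change sat (∅ ∪ s) _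
    rw [Finset.empty_union, smc]
    rintro ⟨ha, hb⟩
    obtain ⟨k, hk, e1, e2⟩ := fresh_odd s
    have := (smc _ _ _).1 (hs {k} (syp k hk))
    apply this
    rw [e1, e2, Nat.bodd_succ, ha, hb]
    simp
  have sb2 : ∀ i, sat ∅ (.imp (.imp (xPrime enc W) (mc enc (!i) i)) (mc enc i i)) := by
    intro i s hs
    change sat (∅ ∪ s) _
    rw [Finset.empty_union, smc]
    rintro ⟨ha, hb⟩
    obtain ⟨k, hk, e1, e2⟩ := fresh_even s
    have := (smc _ _ _).1 (hs {k} (sxp k hk))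
    apply this
    rw [e1, e2, Nat.bodd_succ, ha, hb]
    simp
  have key := hval V ∅ ⟨?_, ⟨sb1 false, sb1 true⟩, ⟨sb2 false, sb2 true⟩, ?_, sG ∅⟩ {0}
    (sxp 0 rfl)
  · have key' : sat ((∅ ∪ ∅) ∪ {0}) (mc enc true false) := key
    rw [smc] at key'
    apply key'
    constructor <;> decide
  · refine sat_bigAnd (spp _) ?_
    intro f hf
    obtain ⟨p, -, rfl⟩ := List.mem_map.1 hf
    intro s hs
    change sat (∅ ∪ s) _
    rw [Finset.empty_union]
    exact hs
  · intro s _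
    change sat (∅ ∪ s) _
    rw [Finset.empty_union]
    exact sat_bigOr (List.mem_map.2 ⟨((ev s).bodd, (od s).bodd), mem_boolPairs _, rfl⟩) (sG s)

end TT

/-- for any set of formulas `L` with
`TWJ⁺ ⊆ L ⊆ Log(𝒫_fin(ℕ), ∪, ∅)`, the tiling formula `ψ_W` is outside `L` iff
`W` tiles `ℤ²`. -/
theorem psiW_membership_iff_tiling (W : Finset Tile) (enc : Letter → ℕ)
    (henc : Function.Injective enc) (L : Set Fml)
    (hTWJ : ∀ φ : Fml, TWJ φ → φ ∈ L)
    (hLog : ∀ φ ∈ L, InLogPfin φ) :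
    psiW enc W ∉ L ↔ Tiles W Set.univ := by
  constructor
  · intro h
    have hno : ¬ TWJ (psiW enc W) := fun h' => h (hTWJ _ h')
    exact TT.tiles_of_octants W (TT.octant_tiling W enc hno)
  · intro h hL
    exact TT.not_valid W enc henc h (hLog _ hL)
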